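/- Let α ∈ (1,2), n ≥ 1 an integer, and w > 0. Then the matrix P_n = w·τ(G_n^{(α)}) is symmetric positive definite. -/

import Mathlib

/-- Grünwald–Letnikov coefficients: `g 0 = 1`, `g k = (1 - (α+1)/k) * g (k-1)` for `k ≥ 1`. -/
noncomputable def glCoef (α : ℝ) : ℕ → ℝ
  | 0 => 1
  | k + 1 => (1 - (α + 1) / ((k : ℝ) + 1)) * glCoef α k

/-- First-column entries of `G_n^{(α)}`: `t_0 = -2g_1`, `t_1 = -(g_0+g_2)`, `t_k = -g_{k+1}` for `k ≥ 2`. -/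
noncomputable def tC (α : ℝ) : ℕ → ℝ
  | 0 => -2 * glCoef α 1
  | 1 => -(glCoef α 0 + glCoef α 2)
  | k + 2 => -glCoef α (k + 3)

/-- Padded coefficients: `t_k` for `k < n`, `0` for `k ≥ n`. -/
noncomputable def tpad (n : ℕ) (t : ℕ → ℝ) (k : ℕ) : ℝ := if k < n then t k else 0

/-- The `n×n` symmetric Toeplitz matrix with `(i,j)` entry `t_{|i-j|}`. -/
noncomputable def toeplitzM (n : ℕ) (t : ℕ → ℝ) : Matrix (Fin n) (Fin n) ℝ :=
  fun i j => t (Nat.dist i.val j.val)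

/-- The Hankel matrix `(H_n)_{ij} = t_{i+j} + t_{2(n+1)-(i+j)}` (1-based indices,
with the convention `t_k = 0` for `k ≥ n`). Here `i j : Fin n` are 0-based. -/
noncomputable def hankelM (n : ℕ) (t : ℕ → ℝ) : Matrix (Fin n) (Fin n) ℝ :=
  fun i j => tpad n t (i.val + j.val + 2) + tpad n t (2 * n - (i.val + j.val))

/-- The τ-matrix `τ(T_n) = T_n - H_n`. -/
noncomputable def tauM (n : ℕ) (t : ℕ → ℝ) : Matrix (Fin n) (Fin n) ℝ :=
  toeplitzM n t - hankelM n t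

/-- The matrix `G_n^{(α)}`. -/
noncomputable def Gmat (α : ℝ) (n : ℕ) : Matrix (Fin n) (Fin n) ℝ := toeplitzM n (tC α)

theorem succ_mul_glCoef_succ (α : ℝ) (N : ℕ) :
    ((N : ℝ) + 1) * glCoef α (N + 1) = -α * ∑ k ∈ Finset.range (N + 1), glCoef α k := by
  induction N with
  | zero => simp [glCoef]
  | succ N ih =>
    have h : ((N : ℝ) + 2) * glCoef α (N + 2) = (N + 1 - α) * glCoef α (N + 1) := by
      have hN : (N : ℝ) + 1 + 1 ≠ 0 := by positivity
      rw [show glCoef α (N + 2) = (1 - (α + 1) / (((N + 1 : ℕ) : ℝ) + 1)) * glCoef α (N + 1)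
        from rfl]
      push_cast
      field_simp
      ring
    rw [Finset.sum_range_succ, mul_add, ← ih]
    push_cast
    linear_combination h

theorem glCoef_pos {α : ℝ} (hα : α ∈ Set.Ioo (1 : ℝ) 2) (k : ℕ) : 0 < glCoef α (k + 2) := by
  obtain ⟨h1, h2⟩ := hα
  induction k with
  | zero =>
    simp only [glCoef]
    norm_num
    nlinarith
  | succ k ih =>
    refine mul_pos ?_ ih
    rw [sub_pos, div_lt_one (by positivity)]
    push_cast
    have : (0 : ℝ) ≤ k := k.cast_nonneg
    linarith

theorem sum_glCoef_neg {α : ℝ} (hα : α ∈ Set.Ioo (1 : ℝ) 2) (N : ℕ) :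
    ∑ k ∈ Finset.range (N + 2), glCoef α k < 0 := by
  have h := succ_mul_glCoef_succ α (N + 1)
  have hpos : 0 < (((N + 1 : ℕ) : ℝ) + 1) * glCoef α (N + 1 + 1) :=
    mul_pos (by positivity) (glCoef_pos hα N)
  have hα0 : 0 < α := by linarith [hα.1]
  by_contra! hc
  nlinarith [mul_nonneg hα0.le hc]

theorem tC_succ_neg {α : ℝ} (hα : α ∈ Set.Ioo (1 : ℝ) 2) (k : ℕ) : tC α (k + 1) < 0 := by
  cases k with
  | zero =>
    have : 0 < glCoef α 2 := glCoef_pos hα 0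
    simp only [tC, glCoef] at this ⊢
    linarith
  | succ k => exact neg_neg_of_pos (glCoef_pos hα (k + 1))

theorem sum_neg_tC_succ (α : ℝ) (N : ℕ) :
    ∑ k ∈ Finset.range (N + 1), -tC α (k + 1)
      = ∑ k ∈ Finset.range (N + 3), glCoef α k + α := by
  induction N with
  | zero =>
    simp [Finset.sum_range_succ, tC, glCoef]
    ring
  | succ N ih =>
    rw [Finset.sum_range_succ, ih, Finset.sum_range_succ _ (N + 3)]
    simp only [tC]
    ring

theorem sum_neg_tC_lt {α : ℝ} (hα : α ∈ Set.Ioo (1 : ℝ) 2) (N : ℕ) :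
    ∑ k ∈ Finset.range N, -tC α (k + 1) < α := by
  cases N with
  | zero => simpa using by linarith [hα.1]
  | succ N =>
    rw [sum_neg_tC_succ]
    linarith [sum_glCoef_neg hα (N + 1)]

theorem tpad_nonpos {n : ℕ} {t : ℕ → ℝ} {k : ℕ} (ht : t k ≤ 0) : tpad n t k ≤ 0 := by
  unfold tpad; split_ifs <;> linarith

theorem le_tpad {n : ℕ} {t : ℕ → ℝ} {k : ℕ} (ht : t k ≤ 0) : t k ≤ tpad n t k := by
  unfold tpad; split_ifs <;> linarith

theorem tauM_isSymm (n : ℕ) (t : ℕ → ℝ) : (tauM n t).IsSymm := by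
  ext i j
  simp [tauM, toeplitzM, hankelM, Nat.dist_comm, Nat.add_comm]

/-- Each row of a τ-matrix is bounded by two disjoint families of coefficients. -/
theorem tauM_row_dominant {n : ℕ} {t : ℕ → ℝ} {c : ℝ} (ht : ∀ k, t (k + 1) ≤ 0)
    (hc : ∀ N, ∑ k ∈ Finset.range N, -t (k + 1) < c) (h0 : 2 * c ≤ t 0) (i : Fin n) :
    ∑ j ∈ Finset.univ.erase i, ‖tauM n t i j‖ < tauM n t i i := by
  have ht' : ∀ k, 0 < k → t k ≤ 0 := by
    rintro (_ | k) hk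
    · omega
    · exact ht k
  have hdiag : t 0 ≤ tauM n t i i := by
    have h1 : tpad n t (i.val + i.val + 2) ≤ 0 := tpad_nonpos (ht' _ (by omega))
    have h2 : tpad n t (2 * n - (i.val + i.val)) ≤ 0 := tpad_nonpos (ht' _ (by omega))
    simp only [tauM, toeplitzM, hankelM, Matrix.sub_apply, Nat.dist_self]
    linarith
  let f : ℕ → ℝ := fun j => if j = i.val then 0 else -t (Nat.dist i.val j)
  let g : ℕ → ℝ := fun j => -t (i.val + j + 2) - t (2 * n - (i.val + j))
  have hg : ∀ j : Fin n, 0 ≤ g j := fun j => by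
    have h1 := ht' (i.val + j.val + 2) (by omega)
    have h2 := ht' (2 * n - (i.val + j.val)) (by omega)
    simp only [g]
    linarith
  have hoff : ∑ j ∈ Finset.univ.erase i, ‖tauM n t i j‖ ≤ ∑ j : Fin n, (f j + g j) := by
    have hle : ∀ j ∈ Finset.univ.erase i, ‖tauM n t i j‖ ≤ f j + g j := by
      intro j hj
      have hji : j.val ≠ i.val := fun h => (Finset.ne_of_mem_erase hj) (Fin.ext h)
      have hd := ht' (Nat.dist i.val j.val) (Nat.dist_pos_of_ne (Ne.symm hji))
      have h1 := ht' (i.val + j.val + 2) (by omega)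
      have h2 := ht' (2 * n - (i.val + j.val)) (by omega)
      have h3 := tpad_nonpos (n := n) h1
      have h4 := tpad_nonpos (n := n) h2
      have h5 := le_tpad (n := n) h1
      have h6 := le_tpad (n := n) h2
      simp only [tauM, toeplitzM, hankelM, Matrix.sub_apply, f, g, if_neg hji, Real.norm_eq_abs]
      rw [abs_le]
      constructor <;> linarith
    refine (Finset.sum_le_sum hle).trans
      (Finset.sum_le_sum_of_subset_of_nonneg (Finset.subset_univ _) fun j _ hj => ?_)
    have hji : j = i := by simpa using hj
    simpa [f, hji] using hg i
  obtain ⟨m, hm⟩ : ∃ m, n = i.val + 1 + m := ⟨n - (i.val + 1), by omega⟩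
  have hf : ∑ j ∈ Finset.range n, f j = ∑ k ∈ Finset.range i.val, -t (k + 1)
      + ∑ k ∈ Finset.range m, -t (k + 1) := by
    rw [congrArg (fun N => ∑ j ∈ Finset.range N, f j) hm, Finset.sum_range_add,
      Finset.sum_range_succ,
      ← Finset.sum_range_reflect (fun k => -t (k + 1)) i.val]
    have hfi : f i.val = 0 := by simp [f]
    rw [hfi, add_zero]
    congr 1
    · refine Finset.sum_congr rfl fun j hj => ?_
      have hj := Finset.mem_range.1 hj
      simp only [f, if_neg hj.ne, Nat.dist_eq_sub_of_le_right hj.le]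
      congr 2
      omega
    · refine Finset.sum_congr rfl fun j _ => ?_
      simp only [f, if_neg (show i.val + 1 + j ≠ i.val by omega),
        Nat.dist_eq_sub_of_le (show i.val ≤ i.val + 1 + j by omega)]
      congr 2
      omega
  have hgs : ∑ j ∈ Finset.range n, g j = ∑ k ∈ Finset.range n, -t (i.val + 1 + k + 1)
      + ∑ k ∈ Finset.range n, -t (m + 1 + k + 1) := by
    rw [← Finset.sum_range_reflect (fun k => -t (m + 1 + k + 1)) n, ← Finset.sum_add_distrib]
    refine Finset.sum_congr rfl fun j hj => ?_
    have hj := Finset.mem_range.1 hj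
    simp only [g]
    rw [show i.val + 1 + j + 1 = i.val + j + 2 by omega,
      show m + 1 + (n - 1 - j) + 1 = 2 * n - (i.val + j) by omega]
    ring
  have hsplit : ∀ a, ∑ k ∈ Finset.range a, -t (k + 1)
      + ∑ k ∈ Finset.range n, -t (a + 1 + k + 1) < c := fun a => by
    have h := hc (a + 1 + n)
    rw [Finset.sum_range_add, Finset.sum_range_succ] at h
    linarith [ht a]
  have hsum : ∑ j : Fin n, (f j + g j)
      = ∑ j ∈ Finset.range n, f j + ∑ j ∈ Finset.range n, g j := by
    rw [Fin.sum_univ_eq_sum_range (fun j => f j + g j), Finset.sum_add_distrib]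
  linarith [hsplit i.val, hsplit m]

theorem Matrix.IsSymm.posDef_of_row_dominant {ι : Type*} [Fintype ι] [DecidableEq ι]
    {A : Matrix ι ι ℝ} (hA : A.IsSymm)
    (h : ∀ i, ∑ j ∈ Finset.univ.erase i, ‖A i j‖ < A i i) : A.PosDef := by
  have hH : A.IsHermitian := by
    rwa [Matrix.IsHermitian, Matrix.conjTranspose_eq_transpose_of_trivial]
  refine hH.posDef_iff_eigenvalues_pos.2 fun i => ?_
  have hev : Module.End.HasEigenvalue (Matrix.toLin' A) (hH.eigenvalues i) := by
    rw [Module.End.hasEigenvalue_iff_mem_spectrum, Matrix.spectrum_toLin']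
    exact hH.eigenvalues_mem_spectrum_real i
  obtain ⟨k, hk⟩ := eigenvalue_mem_ball hev
  rw [Metric.mem_closedBall, Real.dist_eq] at hk
  linarith [(abs_le.1 hk).1, h k]

theorem tau_G_posDef (α : ℝ) (hα : α ∈ Set.Ioo (1 : ℝ) 2) (n : ℕ) (hn : 1 ≤ n)
    (w : ℝ) (hw : 0 < w) :
    (w • tauM n (tC α)).IsSymm ∧ (w • tauM n (tC α)).PosDef := by
  have hsymm := tauM_isSymm n (tC α)
  refine ⟨hsymm.smul w, Matrix.PosDef.smul (hsymm.posDef_of_row_dominant ?_) hw⟩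
  refine tauM_row_dominant (fun k => (tC_succ_neg hα k).le) (sum_neg_tC_lt hα) ?_
  simp [tC, glCoef]
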